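/- arXiv:2006.06724 — 2 statements merged into one kernel-verified Lean document; each statement's English description precedes it below -/
import Mathlib

section
/- For every positive integer n there exists a bijection R from the set of all functions f : {1,…,n} → {1,…,n} to the set of doubly rooted trees on n vertices such that for every such f, the symmetric difference of the undirected edge multiset E(f) of the functional graph of f and the edge set of the tree R(f) has size at most 2·c(f), where c(f) is the number of cycles of f. -/
open scoped Classical

/-- The core of a self-map: the set of points lying on a cycle,
i.e. `x` with `f^[j] x = x` for some `j ≥ 1`. -/
def inCore {V : Type*} (f : V → V) (x : V) : Prop := ∃ j ≥ 1, f^[j] x = x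

/-- The number of cycles of a self-map: the number of distinct forward orbits
of points of the core (each cycle is the forward orbit of any of its points). -/
noncomputable def cycleCount {V : Type*} (f : V → V) : ℕ :=
  Set.ncard ((fun x => {y | ∃ j : ℕ, f^[j] x = y}) '' {x | inCore f x})

/-- The undirected edge multiset of the functional graph of `f` : the multiset of
unordered pairs `{x, f x}`, with multiplicity, loops allowed. -/
def funEdges {n : ℕ} (f : Fin n → Fin n) : Multiset (Sym2 (Fin n)) :=
  Finset.univ.val.map (fun x => s(x, f x))

/-- The edge multiset of a simple graph on `Fin n` (each edge counted once). -/
noncomputable def graphEdges {n : ℕ} (G : SimpleGraph (Fin n)) : Multiset (Sym2 (Fin n)) :=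
  (G.edgeSet.toFinite.toFinset).val

/-- Size of the multiset symmetric difference `(A - B) + (B - A)`. -/
noncomputable def msdCard {α : Type*} (A B : Multiset α) : ℕ :=
  Multiset.card ((A - B) + (B - A))

/-- A doubly rooted tree on `n` vertices: a tree on vertex set `Fin n`
together with an ordered pair of roots. -/
structure DoublyRootedTree (n : ℕ) where
  tree : SimpleGraph (Fin n)
  isTree : tree.IsTree
  r1 : Fin n
  r2 : Fin n

theorem eq_of_isPeriodicPt_of_iterate_eq {V : Type*} {p : V → V} {x r : V} {i j : ℕ}
    (hi : p^[i + 1] x = x) (hj : p^[j] x = r) (hr : p r = r) : x = r := by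
  have h1 : p^[(i + 1) * j] x = x :=
    Function.IsPeriodicPt.mul_const (f := p) (m := i + 1) hi j
  have h2 : (i + 1) * j = i * j + j := by ring
  rw [h2, Function.iterate_add_apply, hj, Function.iterate_fixed hr] at h1
  exact h1.symm

theorem exists_iterate_mem_of_eqOn_compl {V : Type*} {f g : V → V} {S : Set V}
    (hfg : ∀ x ∉ S, f x = g x) (h : ∀ x, ∃ j, g^[j] x ∈ S) (x : V) : ∃ j, f^[j] x ∈ S := by
  obtain ⟨j, hj⟩ := h x
  induction j generalizing x with
  | zero => exact ⟨0, hj⟩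
  | succ j ih =>
    by_cases hx : x ∈ S
    · exact ⟨0, hx⟩
    · obtain ⟨i, hi⟩ := ih (g x) hj
      exact ⟨i + 1, by rwa [Function.iterate_succ_apply, hfg x hx]⟩

theorem exists_iterate_inCore {V : Type*} [Finite V] (f : V → V) (x : V) :
    ∃ j, inCore f (f^[j] x) := by
  obtain ⟨a, b, hab, e⟩ : ∃ a b : ℕ, a < b ∧ f^[a] x = f^[b] x := by
    obtain ⟨a, b, hne, e⟩ := Finite.exists_ne_map_eq_of_infinite (fun j : ℕ => f^[j] x)
    rcases lt_or_gt_of_ne hne with h | h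
    · exact ⟨a, b, h, e⟩
    · exact ⟨b, a, h, e.symm⟩
  refine ⟨a, b - a, by omega, ?_⟩
  rw [← Function.iterate_add_apply, Nat.sub_add_cancel hab.le, e]

section Word

variable {V : Type*} [LinearOrder V]

/-- The minimum of the nonempty list `a :: l`. -/
def listMin : V → List V → V
  | a, [] => a
  | a, h :: l => min a (listMin h l)

theorem listMin_mem (a : V) (l : List V) : listMin a l ∈ a :: l := by
  induction l generalizing a with
  | nil => simp [listMin]
  | cons h l ih =>
    rcases min_choice a (listMin h l) with e | e
    · simp [listMin, e]
    · rw [listMin, e]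
      exact List.mem_cons_of_mem _ (ih h)

theorem listMin_le (a : V) (l : List V) : ∀ x ∈ a :: l, listMin a l ≤ x := by
  induction l generalizing a with
  | nil => simp [listMin]
  | cons h l ih =>
    intro x hx
    rcases List.mem_cons.1 hx with rfl | hx
    · exact min_le_left _ _
    · exact (min_le_right _ _).trans (ih h x hx)

theorem listMin_congr {a b : V} {l l' : List V} (h : ∀ x, x ∈ a :: l ↔ x ∈ b :: l') :
    listMin a l = listMin b l' :=
  le_antisymm (listMin_le a l _ ((h _).2 (listMin_mem b l')))
    (listMin_le b l' _ ((h _).1 (listMin_mem a l)))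

/-- Foata's fundamental transformation, sending a word to a permutation of its letters. -/
def foata : List V → Equiv.Perm V
  | [] => 1
  | a :: l => Equiv.swap a (listMin a l) * foata l

theorem foata_apply_of_notMem (w : List V) {x : V} (hx : x ∉ w) : foata w x = x := by
  induction w with
  | nil => rfl
  | cons a l ih =>
    rw [foata, Equiv.Perm.mul_apply, ih (fun h => hx (List.mem_cons_of_mem _ h))]
    refine Equiv.swap_apply_of_ne_of_ne (fun h => hx (by simp [h])) (fun h => hx ?_)
    rw [h]
    exact listMin_mem a l

theorem foata_apply_mem_iff (w : List V) {x : V} : foata w x ∈ w ↔ x ∈ w := by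
  constructor
  · intro h
    by_contra hx
    rw [foata_apply_of_notMem w hx] at h
    exact hx h
  · intro hx
    by_contra h
    have h' := (foata w).injective (foata_apply_of_notMem w h)
    rw [h'] at h
    exact h hx

theorem foata_cons_apply_head {a : V} {l : List V} (ha : a ∉ l) :
    foata (a :: l) a = listMin a l := by
  rw [foata, Equiv.Perm.mul_apply, foata_apply_of_notMem l ha, Equiv.swap_apply_left]

theorem foata_injective {w w' : List V} (hw : w.Nodup) (hw' : w'.Nodup)
    (h : ∀ x, x ∈ w ↔ x ∈ w') (e : foata w = foata w') : w = w' := by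
  induction w generalizing w' with
  | nil =>
    symm
    rw [List.eq_nil_iff_forall_not_mem]
    intro x hx
    simpa using (h x).2 hx
  | cons a l ih =>
    rcases w' with _ | ⟨b, l'⟩
    · simpa using (h a).1 (by simp)
    have hm := listMin_congr h
    rw [List.nodup_cons] at hw hw'
    have hab : a = b := by
      apply (foata (a :: l)).injective
      rw [foata_cons_apply_head hw.1, e, foata_cons_apply_head hw'.1, hm]
    subst hab
    congr 1
    refine ih hw.2 hw'.2 (fun x => ?_) ?_
    · have := h x
      have h1 := hw.1
      have h2 := hw'.1
      simp only [List.mem_cons] at this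
      by_cases hx : x = a
      · subst hx
        simp [h1, h2]
      · simpa [hx] using this
    · rw [foata, foata, hm] at e
      exact mul_left_cancel e

theorem exists_foata_eq (S : Finset V) (σ : Equiv.Perm V) (hσ : ∀ x ∉ S, σ x = x) :
    ∃ w : List V, w.Nodup ∧ (∀ x, x ∈ w ↔ x ∈ S) ∧ foata w = σ := by
  induction hk : S.card generalizing S σ with
  | zero =>
    rw [Finset.card_eq_zero] at hk
    subst hk
    refine ⟨[], by simp, by simp, ?_⟩
    ext x
    simp [foata, hσ x]
  | succ k ih =>
    have hS : S.Nonempty := Finset.card_pos.1 (by omega)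
    obtain ⟨a, ha⟩ := σ.surjective (S.min' hS)
    have haS : a ∈ S := by
      by_contra h
      rw [hσ a h] at ha
      rw [ha] at h
      exact h (S.min'_mem hS)
    obtain ⟨l, hl, hmem, hf⟩ := ih (S.erase a) (Equiv.swap a (S.min' hS) * σ) (by
      intro x hx
      rw [Equiv.Perm.mul_apply]
      by_cases hxa : x = a
      · rw [hxa, ha, Equiv.swap_apply_right]
      · have hxS : x ∉ S := fun h => hx (Finset.mem_erase.2 ⟨hxa, h⟩)
        rw [hσ x hxS]
        refine Equiv.swap_apply_of_ne_of_ne hxa (fun h => hxS ?_)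
        rw [h]
        exact S.min'_mem hS) (by rw [Finset.card_erase_of_mem haS, hk]; rfl)
    have hmem' : ∀ x, x ∈ a :: l ↔ x ∈ S := by
      intro x
      rw [List.mem_cons, hmem, Finset.mem_erase]
      by_cases hxa : x = a
      · simp [hxa, haS]
      · simp [hxa]
    refine ⟨a :: l, ?_, hmem', ?_⟩
    · rw [List.nodup_cons]
      exact ⟨by simp [hmem], hl⟩
    · have hm : listMin a l = S.min' hS :=
        le_antisymm (listMin_le a l _ ((hmem' _).2 (S.min'_mem hS)))
          (S.min'_le _ ((hmem' _).1 (listMin_mem a l)))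
      rw [foata, hf, hm, ← mul_assoc, Equiv.swap_mul_self, one_mul]

/-- The least element of the cycle of `foata w` through a given point. -/
def cycleMin : List V → V → V
  | [], x => x
  | a :: l, x => if x = a then listMin a l else cycleMin l x

theorem cycleMin_listMin {a : V} {l : List V} (h : (a :: l).Nodup) :
    cycleMin (a :: l) (listMin a l) = listMin a l := by
  induction l generalizing a with
  | nil => simp [cycleMin, listMin]
  | cons b l ih =>
    rw [cycleMin]
    split_ifs with hm
    · rfl
    · rcases min_choice a (listMin b l) with e | e
      · exact absurd e hm
      · rw [listMin, e]
        exact ih (List.nodup_cons.1 h).2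

theorem cycleMin_mem {w : List V} {x : V} (hx : x ∈ w) : cycleMin w x ∈ w := by
  induction w with
  | nil => simp at hx
  | cons a l ih =>
    rw [cycleMin]
    split_ifs with h
    · exact listMin_mem a l
    · exact List.mem_cons_of_mem _ (ih ((List.mem_cons.1 hx).resolve_left h))

theorem cycleMin_foata {w : List V} (hw : w.Nodup) (x : V) :
    cycleMin w (foata w x) = cycleMin w x := by
  induction w generalizing x with
  | nil => rfl
  | cons a l ih =>
    have hw' := List.nodup_cons.1 hw
    by_cases hxa : x = a
    · subst hxa
      rw [foata_cons_apply_head hw'.1, cycleMin_listMin hw, cycleMin, if_pos rfl]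
    have hya : foata l x ≠ a := by
      intro h
      rw [← foata_apply_of_notMem l hw'.1] at h
      exact hxa ((foata l).injective h)
    have hx : cycleMin (a :: l) x = cycleMin l x := by rw [cycleMin, if_neg hxa]
    rw [hx, foata, Equiv.Perm.mul_apply, ← ih hw'.2 x]
    by_cases hym : foata l x = listMin a l
    · rw [hym, Equiv.swap_apply_right, cycleMin, if_pos rfl]
      have h := cycleMin_listMin hw
      rw [cycleMin, if_neg (by rwa [← hym])] at h
      exact h.symm
    · rw [Equiv.swap_apply_of_ne_of_ne hya hym, cycleMin, if_neg hya]

/-- The number of cycles of `foata w`. -/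
def foataCycles (w : List V) : ℕ := (w.toFinset.image (cycleMin w)).card

theorem foataCycles_pos (a : V) (l : List V) : 0 < foataCycles (a :: l) :=
  Finset.card_pos.2 ⟨_, Finset.mem_image_of_mem _ (by simp : a ∈ (a :: l).toFinset)⟩

theorem image_cycleMin_cons {a : V} {l : List V} (ha : a ∉ l) :
    (a :: l).toFinset.image (cycleMin (a :: l)) =
      insert (listMin a l) (l.toFinset.image (cycleMin l)) := by
  rw [List.toFinset_cons, Finset.image_insert, cycleMin, if_pos rfl]
  congr 1
  refine Finset.image_congr fun x hx => ?_
  rw [cycleMin, if_neg]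
  rintro rfl
  exact ha (by simpa using hx)

theorem foataCycles_cons_of_eq {a : V} {l : List V} (ha : a ∉ l) (hm : listMin a l = a) :
    foataCycles (a :: l) = foataCycles l + 1 := by
  rw [foataCycles, image_cycleMin_cons ha, hm, Finset.card_insert_of_notMem, foataCycles]
  intro h
  obtain ⟨x, hx, e⟩ := Finset.mem_image.1 h
  exact ha (e ▸ cycleMin_mem (by simpa using hx))

theorem foataCycles_le_cons {a : V} {l : List V} (ha : a ∉ l) :
    foataCycles l ≤ foataCycles (a :: l) := by
  rw [foataCycles, foataCycles, image_cycleMin_cons ha]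
  exact Finset.card_le_card (Finset.subset_insert _ _)

/-- The successor of a letter in a word, the last letter (like every letter outside the word)
being its own successor. -/
def wordNext : List V → V → V
  | [], x => x
  | a :: l, x => if x = a then l.headD a else wordNext l x

theorem wordNext_cons_of_mem {a x : V} {l : List V} (h : (a :: l).Nodup) (hx : x ∈ l) :
    wordNext (a :: l) x = wordNext l x := by
  rw [wordNext, if_neg]
  rintro rfl
  exact (List.nodup_cons.1 h).1 hx

theorem foata_edges (a : V) (l : List V) (hw : (a :: l).Nodup) :
    ∃ Q X Y : Multiset (Sym2 V),
      (l.map fun x => s(x, foata (a :: l) x) : Multiset (Sym2 V)) = Q + X ∧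
      ((a :: l).map fun x => s(x, wordNext (a :: l) x) : Multiset (Sym2 V)) =
        s((a :: l).getLast (by simp), (a :: l).getLast (by simp)) ::ₘ (Q + Y) ∧
      X.card + 1 ≤ foataCycles (a :: l) ∧ Y.card + 1 ≤ foataCycles (a :: l) := by
  induction l generalizing a with
  | nil =>
    exact ⟨0, 0, 0, by simp, by simp [wordNext], foataCycles_pos a [], foataCycles_pos a []⟩
  | cons h l ih =>
    have hw' := List.nodup_cons.1 hw
    have hh := (List.nodup_cons.1 hw'.2).1
    obtain ⟨Q, X, Y, hQX, hQY, hX, hY⟩ := ih h hw'.2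
    have hnext : ((a :: h :: l).map fun x => s(x, wordNext (a :: h :: l) x)
        : Multiset (Sym2 V)) = s(a, h) ::ₘ
          ((h :: l).map fun x => s(x, wordNext (h :: l) x) : Multiset (Sym2 V)) := by
      rw [List.map_cons, ← Multiset.cons_coe]
      congr 1
      · simp [wordNext]
      · congr 1
        refine List.map_congr_left fun x hx => ?_
        rw [wordNext_cons_of_mem hw hx]
    rw [hnext, hQY]
    have hlast : (a :: h :: l).getLast (by simp) = (h :: l).getLast (by simp) := by simp
    by_cases hm : listMin a (h :: l) = a
    · have hf : foata (a :: h :: l) = foata (h :: l) := by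
        rw [foata, hm, Equiv.swap_self]
        exact one_mul _
      rw [foataCycles_cons_of_eq hw'.1 hm]
      refine ⟨Q, s(h, foata (h :: l) h) ::ₘ X, s(a, h) ::ₘ Y, ?_, ?_, ?_, ?_⟩
      · rw [hf, List.map_cons, ← Multiset.cons_coe, hQX, Multiset.add_cons]
      · rw [hlast, Multiset.add_cons, Multiset.cons_swap]
      · simpa using hX
      · simpa using hY
    · have hm' : listMin a (h :: l) = listMin h l :=
        (min_choice a (listMin h l)).resolve_left hm
      have hle := foataCycles_le_cons hw'.1
      refine ⟨s(a, h) ::ₘ Q, X, Y, ?_, ?_, hX.trans hle, hY.trans hle⟩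
      · rw [List.map_cons, ← Multiset.cons_coe, Multiset.cons_add, ← hQX]
        congr 1
        · rw [foata, Equiv.Perm.mul_apply, foata_cons_apply_head hh, hm',
            Equiv.swap_apply_right, Sym2.eq_swap]
        · congr 1
          refine List.map_congr_left fun x hx => ?_
          have hxl : x ∈ h :: l := List.mem_cons_of_mem _ hx
          rw [foata, Equiv.Perm.mul_apply, hm', Equiv.swap_apply_of_ne_of_ne]
          · intro e
            exact hw'.1 (e ▸ (foata_apply_mem_iff _).2 hxl)
          · intro e
            rw [← foata_cons_apply_head hh] at e
            exact hh ((foata (h :: l)).injective e ▸ hx)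
      · rw [hlast, Multiset.cons_add, Multiset.cons_swap]

theorem iterate_eq_getLast_of_eq_wordNext {p : V → V} (a : V) (l : List V) (h : (a :: l).Nodup)
    (hp : ∀ x ∈ a :: l, p x = wordNext (a :: l) x) :
    ∀ x ∈ a :: l, ∃ j, p^[j] x = (a :: l).getLast (by simp) := by
  induction l generalizing a with
  | nil =>
    intro x hx
    exact ⟨0, by simpa using hx⟩
  | cons b l ih =>
    have ih := ih b (List.nodup_cons.1 h).2 fun x hx => by
      rw [hp x (List.mem_cons_of_mem _ hx), wordNext_cons_of_mem h hx]
    intro x hx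
    rcases List.mem_cons.1 hx with rfl | hx
    · obtain ⟨j, hj⟩ := ih b (by simp)
      refine ⟨j + 1, ?_⟩
      rw [Function.iterate_succ_apply, hp x (by simp)]
      simpa [wordNext] using hj
    · simpa using ih x hx

theorem wordNext_getLast (a : V) (l : List V) (h : (a :: l).Nodup) :
    wordNext (a :: l) ((a :: l).getLast (by simp)) = (a :: l).getLast (by simp) := by
  induction l generalizing a with
  | nil => simp [wordNext]
  | cons b l ih =>
    rw [List.getLast_cons (by simp), wordNext_cons_of_mem h (List.getLast_mem _)]
    exact ih b (List.nodup_cons.1 h).2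

theorem eq_of_eq_wordNext {p : V → V} (a : V) (l l' : List V)
    (h : (a :: l).Nodup) (h' : (a :: l').Nodup)
    (hp : ∀ x ∈ a :: l, p x = wordNext (a :: l) x)
    (hp' : ∀ x ∈ a :: l', p x = wordNext (a :: l') x) : l = l' := by
  induction l generalizing a l' with
  | nil =>
    rcases l' with _ | ⟨b, l'⟩
    · rfl
    · have h1 := (hp a (by simp)).symm.trans (hp' a (by simp))
      simp only [wordNext, if_true, List.headD_nil, List.headD_cons] at h1
      simp [h1] at h'
  | cons b l ih =>
    have h1 := (hp a (by simp)).symm.trans (hp' a (by simp))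
    rcases l' with _ | ⟨b', l'⟩
    · simp only [wordNext, if_true, List.headD_nil, List.headD_cons] at h1
      simp [h1] at h
    · simp only [wordNext, if_true, List.headD_cons] at h1
      subst h1
      rw [ih b l' (List.nodup_cons.1 h).2 (List.nodup_cons.1 h').2
        (fun x hx => by rw [hp x (List.mem_cons_of_mem _ hx), wordNext_cons_of_mem h hx])
        (fun x hx => by rw [hp' x (List.mem_cons_of_mem _ hx), wordNext_cons_of_mem h' hx])]

theorem exists_wordNext_eq {p : V → V} {r : V} (hr : p r = r) (j : ℕ) (x : V)
    (hj : p^[j] x = r) :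
    ∃ l, ∃ _ : (x :: l).Nodup, (x :: l).getLast (by simp) = r ∧
      (∀ y ∈ x :: l, p y = wordNext (x :: l) y) ∧ ∀ y ∈ x :: l, ∃ i, p^[i] x = y := by
  induction j generalizing x with
  | zero =>
    have hx : x = r := hj
    subst hx
    exact ⟨[], by simp, by simp, by simp [wordNext, hr], by simpa using ⟨0, rfl⟩⟩
  | succ j ih =>
    by_cases hx : x = r
    · subst hx
      exact ⟨[], by simp, by simp, by simp [wordNext, hr], by simpa using ⟨0, rfl⟩⟩
    obtain ⟨l, hl, hlast, hp, hi⟩ := ih (p x) hj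
    have hxl : x ∉ p x :: l := by
      intro h
      obtain ⟨i, hi⟩ := hi x h
      exact hx (eq_of_isPeriodicPt_of_iterate_eq (i := i) hi hj hr)
    have hnd : (x :: p x :: l).Nodup := List.nodup_cons.2 ⟨hxl, hl⟩
    refine ⟨p x :: l, hnd, by simpa using hlast, ?_, ?_⟩
    · intro y hy
      rcases List.mem_cons.1 hy with rfl | hy
      · simp [wordNext]
      · rw [hp y hy, wordNext_cons_of_mem hnd hy]
    · intro y hy
      rcases List.mem_cons.1 hy with rfl | hy
      · exact ⟨0, rfl⟩
      · obtain ⟨i, hi⟩ := hi y hy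
        exact ⟨i + 1, hi⟩

end Word

section ParentGraph

variable {V : Type*}

/-- The graph joining every vertex `x` to its parent `p x`. -/
def parentGraph (p : V → V) : SimpleGraph V := SimpleGraph.fromRel fun x y => p x = y

theorem parentGraph_adj {p : V → V} {x y : V} :
    (parentGraph p).Adj x y ↔ x ≠ y ∧ (p x = y ∨ p y = x) :=
  Iff.rfl

theorem parentGraph_connected {p : V → V} {r : V} (h : ∀ x, ∃ j, p^[j] x = r) :
    (parentGraph p).Connected := by
  have key : ∀ j x, p^[j] x = r → (parentGraph p).Reachable x r := by
    intro j
    induction j with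
    | zero =>
      rintro x rfl
      exact SimpleGraph.Reachable.refl _
    | succ j ih =>
      intro x hx
      refine SimpleGraph.Reachable.trans ?_ (ih (p x) hx)
      by_cases hxp : x = p x
      · rw [← hxp]
      · exact SimpleGraph.Adj.reachable (parentGraph_adj.2 ⟨hxp, Or.inl rfl⟩)
  have key' : ∀ x, (parentGraph p).Reachable x r := fun x => (h x).elim fun j hj => key j x hj
  have : Nonempty V := ⟨r⟩
  exact ⟨fun x y => (key' x).trans (key' y).symm⟩

theorem injOn_parentEdge {p : V → V} {r : V} (hr : p r = r) (h : ∀ x, ∃ j, p^[j] x = r) :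
    Set.InjOn (fun x => s(x, p x)) {x | x ≠ r} := by
  intro x hx y _ e
  rcases Sym2.eq_iff.1 e with ⟨e1, _⟩ | ⟨e1, e2⟩
  · exact e1
  · obtain ⟨j, hj⟩ := h x
    refine absurd (eq_of_isPeriodicPt_of_iterate_eq (i := 1) ?_ hj hr) hx
    simp only [Function.iterate_succ, Function.iterate_zero, Function.comp_apply, id_eq]
    rw [e2, ← e1]

theorem parentGraph_edgeSet {p : V → V} {r : V} (hr : p r = r) (h : ∀ x, ∃ j, p^[j] x = r) :
    (parentGraph p).edgeSet = (fun x => s(x, p x)) '' {x | x ≠ r} := by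
  have hne : ∀ x, x ≠ r → x ≠ p x := by
    intro x hx e
    obtain ⟨j, hj⟩ := h x
    exact hx (eq_of_isPeriodicPt_of_iterate_eq (i := 0) e.symm hj hr)
  ext e
  induction e using Sym2.ind with
  | _ x y =>
    rw [SimpleGraph.mem_edgeSet, parentGraph_adj]
    constructor
    · rintro ⟨hxy, rfl | rfl⟩
      · exact ⟨x, fun e => hxy (by rw [e, hr]), rfl⟩
      · exact ⟨y, fun e => hxy (by rw [e, hr]), Sym2.eq_swap⟩
    · rintro ⟨z, hz, e⟩
      rcases Sym2.eq_iff.1 e with ⟨rfl, rfl⟩ | ⟨rfl, rfl⟩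
      · exact ⟨hne _ hz, Or.inl rfl⟩
      · exact ⟨(hne _ hz).symm, Or.inr rfl⟩

theorem parentGraph_isTree [Finite V] {p : V → V} {r : V} (hr : p r = r)
    (h : ∀ x, ∃ j, p^[j] x = r) : (parentGraph p).IsTree := by
  rw [SimpleGraph.isTree_iff_connected_and_card]
  refine ⟨parentGraph_connected h, ?_⟩
  rw [Nat.card_coe_set_eq, parentGraph_edgeSet hr h,
    (injOn_parentEdge hr h).ncard_image]
  have := Set.ncard_add_ncard_compl {r}
  rw [Set.ncard_singleton] at this
  rw [← this, add_comm]
  rfl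

theorem parentGraph_injective {p q : V → V} {r : V} (hpr : p r = r) (hqr : q r = r)
    (h : ∀ x, ∃ j, p^[j] x = r) (e : parentGraph p = parentGraph q) : p = q := by
  have key : ∀ j x, p^[j] x = r → p x = q x := by
    intro j
    induction j with
    | zero =>
      rintro x rfl
      exact hpr.trans hqr.symm
    | succ j ih =>
      intro x hx
      by_cases hxr : x = r
      · rw [hxr, hpr, hqr]
      have hxp : x ≠ p x := fun h' =>
        hxr (eq_of_isPeriodicPt_of_iterate_eq (i := 0) h'.symm hx hpr)
      have hadj : (parentGraph q).Adj x (p x) := e ▸ parentGraph_adj.2 ⟨hxp, Or.inl rfl⟩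
      rcases (parentGraph_adj.1 hadj).2 with h' | h'
      · exact h'.symm
      · rw [← ih (p x) hx] at h'
        exact absurd (eq_of_isPeriodicPt_of_iterate_eq (i := 1) h' hx hpr) hxr
  funext x
  obtain ⟨j, hj⟩ := h x
  exact key j x hj

theorem exists_parentGraph_eq [Finite V] {G : SimpleGraph V} (hG : G.IsTree) (r : V) :
    ∃ p : V → V, p r = r ∧ (∀ x, ∃ j, p^[j] x = r) ∧ parentGraph p = G := by
  have hstep : ∀ x, ∃ y, (x = r → y = r) ∧ (x ≠ r → G.Adj x y ∧ G.dist y r < G.dist x r) := by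
    intro x
    by_cases hx : x = r
    · exact ⟨r, fun _ => rfl, fun h => absurd hx h⟩
    obtain ⟨w, hw⟩ := hG.connected.exists_walk_length_eq_dist x r
    cases w with
    | nil => exact absurd rfl hx
    | cons hadj w =>
      refine ⟨_, fun h => absurd h hx, fun _ => ⟨hadj, ?_⟩⟩
      rw [← hw, SimpleGraph.Walk.length_cons]
      exact Nat.lt_succ_of_le (SimpleGraph.dist_le w)
  choose p hp hp' using hstep
  have hreach : ∀ k x, G.dist x r ≤ k → ∃ j, p^[j] x = r := by
    intro k
    induction k with
    | zero =>
      intro x hx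
      exact ⟨0, hG.connected.dist_eq_zero_iff.1 (Nat.le_zero.1 hx)⟩
    | succ k ih =>
      intro x hx
      by_cases hxr : x = r
      · exact ⟨0, hxr⟩
      · obtain ⟨j, hj⟩ := ih (p x) (by have := (hp' x hxr).2; omega)
        exact ⟨j + 1, hj⟩
  have hr : p r = r := hp r rfl
  have hreach' : ∀ x, ∃ j, p^[j] x = r := fun x => hreach _ x le_rfl
  refine ⟨p, hr, hreach', ?_⟩
  have hle : parentGraph p ≤ G := by
    intro x y hxy
    obtain ⟨hne, rfl | rfl⟩ := parentGraph_adj.1 hxy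
    · exact (hp' x fun e => hne (by rw [e, hr])).1
    · exact (hp' y fun e => hne (by rw [e, hr])).1.symm
  exact le_antisymm hle
    ((SimpleGraph.isTree_iff_minimal_connected.1 hG).2 (parentGraph_connected hreach') hle)

end ParentGraph

/-- A nonempty word `head :: tail` without repetitions, together with a forest rooted at its
letters; `next` sends every vertex which is not a letter to its parent. -/
@[ext]
structure RootedWord (V : Type*) where
  head : V
  tail : List V
  nodup : (head :: tail).Nodup
  next : V → V
  next_of_mem : ∀ x ∈ head :: tail, next x = x
  exists_iterate_mem : ∀ x, ∃ j, next^[j] x ∈ head :: tail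

namespace RootedWord

variable {V : Type*}

/-- The underlying word. -/
def word (k : RootedWord V) : List V := k.head :: k.tail

theorem word_ne_nil (k : RootedWord V) : k.word ≠ [] := by simp [word]

theorem word_nodup (k : RootedWord V) : k.word.Nodup := k.nodup

theorem eq_of_word_eq {k k' : RootedWord V} (hw : k.word = k'.word)
    (h : ∀ x ∉ k.word, k.next x = k'.next x) : k = k' := by
  have hht := List.cons_eq_cons.1 hw
  refine RootedWord.ext hht.1 hht.2 (funext fun x => ?_)
  by_cases hx : x ∈ k.word
  · have hx' : x ∈ k'.word := hw ▸ hx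
    rw [k.next_of_mem x hx, k'.next_of_mem x hx']
  · exact h x hx

variable [LinearOrder V]

/-- The self-map acting on the word by Foata's permutation and as `next` elsewhere. -/
def toMap (k : RootedWord V) (x : V) : V := if x ∈ k.word then foata k.word x else k.next x

/-- The parent function of the tree obtained by turning the word into a path. -/
def parent (k : RootedWord V) (x : V) : V :=
  if x ∈ k.word then wordNext k.word x else k.next x

/-- The last letter of the word. -/
def root (k : RootedWord V) : V := k.word.getLast k.word_ne_nil

theorem toMap_of_mem (k : RootedWord V) {x : V} (hx : x ∈ k.word) :
    k.toMap x = foata k.word x := if_pos hx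

theorem toMap_of_notMem (k : RootedWord V) {x : V} (hx : x ∉ k.word) :
    k.toMap x = k.next x := if_neg hx

theorem parent_of_mem (k : RootedWord V) {x : V} (hx : x ∈ k.word) :
    k.parent x = wordNext k.word x := if_pos hx

theorem parent_of_notMem (k : RootedWord V) {x : V} (hx : x ∉ k.word) :
    k.parent x = k.next x := if_neg hx

theorem iterate_toMap (k : RootedWord V) {x : V} (hx : x ∈ k.word) (j : ℕ) :
    k.toMap^[j] x = (foata k.word)^[j] x ∧ k.toMap^[j] x ∈ k.word := by
  induction j with
  | zero => exact ⟨rfl, hx⟩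
  | succ j ih =>
    rw [Function.iterate_succ_apply', Function.iterate_succ_apply', ← ih.1,
      k.toMap_of_mem ih.2]
    exact ⟨rfl, (foata_apply_mem_iff _).2 ih.2⟩

theorem inCore_toMap_iff [Finite V] (k : RootedWord V) (x : V) :
    inCore k.toMap x ↔ x ∈ k.word := by
  constructor
  · rintro ⟨m, hm, hx⟩
    obtain ⟨j, hj⟩ := exists_iterate_mem_of_eqOn_compl (S := {x | x ∈ k.word})
      (fun x hx => k.toMap_of_notMem hx) k.exists_iterate_mem x
    have h1 : k.toMap^[m * j] x = x :=
      Function.IsPeriodicPt.mul_const (f := k.toMap) hx j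
    have h2 : m * j = (m * j - j) + j :=
      (Nat.sub_add_cancel (Nat.le_mul_of_pos_left j hm)).symm
    rw [h2, Function.iterate_add_apply] at h1
    rw [← h1]
    exact (k.iterate_toMap hj _).2
  · intro hx
    obtain ⟨m, hm, h⟩ := (foata k.word).injective.mem_periodicPts x
    exact ⟨m, hm, (k.iterate_toMap hx m).1.trans h⟩

theorem toMap_injective [Finite V] : Function.Injective (toMap : RootedWord V → V → V) := by
  intro k k' e
  have hmem : ∀ x, x ∈ k.word ↔ x ∈ k'.word := fun x => by
    rw [← inCore_toMap_iff, e, inCore_toMap_iff]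
  refine eq_of_word_eq (foata_injective k.nodup k'.nodup hmem ?_) ?_
  · ext x
    by_cases hx : x ∈ k.word
    · rw [← k.toMap_of_mem hx, e, k'.toMap_of_mem ((hmem x).1 hx)]
    · rw [foata_apply_of_notMem _ hx, foata_apply_of_notMem _ fun h => hx ((hmem x).2 h)]
  · intro x hx
    rw [← k.toMap_of_notMem hx, e, k'.toMap_of_notMem fun h => hx ((hmem x).2 h)]

theorem toMap_surjective [Finite V] [Nonempty V] :
    Function.Surjective (toMap : RootedWord V → V → V) := by
  intro f
  have := Fintype.ofFinite V
  have hbij := Function.bijOn_periodicPts f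
  have hinj : Function.Injective fun x => if inCore f x then f x else x := by
    intro x y e
    dsimp only at e
    split_ifs at e with hx hy hy
    · exact hbij.injOn hx hy e
    · exact absurd (e ▸ hbij.mapsTo hx) hy
    · exact absurd (e ▸ hbij.mapsTo hy) hx
    · exact e
  obtain ⟨w, hw, hmem, hf⟩ := exists_foata_eq (Finset.univ.filter (inCore f))
    (Equiv.ofBijective _ (Finite.injective_iff_bijective.1 hinj)) (fun x hx => by
      simp only [Finset.mem_filter, Finset.mem_univ, true_and] at hx
      simp [hx])
  simp only [Finset.mem_filter, Finset.mem_univ, true_and] at hmem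
  have hreach := exists_iterate_inCore f
  rcases w with _ | ⟨a, l⟩
  · obtain ⟨j, hj⟩ := hreach (Classical.arbitrary V)
    simpa using (hmem _).2 hj
  refine ⟨⟨a, l, hw, fun x => if inCore f x then x else f x, fun x hx => ?_, ?_⟩, ?_⟩
  · exact if_pos ((hmem x).1 hx)
  · simp only [hmem]
    exact exists_iterate_mem_of_eqOn_compl (S := {x | inCore f x}) (fun x hx => if_neg hx) hreach
  · funext x
    by_cases hx : inCore f x
    · rw [toMap_of_mem _ ((hmem x).2 hx)]
      simp only [word, hf, Equiv.ofBijective_apply, if_pos hx]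
    · rw [toMap_of_notMem _ fun h => hx ((hmem x).1 h)]
      exact if_neg hx

theorem parent_root (k : RootedWord V) : k.parent k.root = k.root := by
  rw [k.parent_of_mem (x := k.root) (List.getLast_mem _)]
  exact wordNext_getLast _ _ k.nodup

theorem exists_iterate_parent_eq_root (k : RootedWord V) (x : V) :
    ∃ j, k.parent^[j] x = k.root := by
  obtain ⟨i, hi⟩ := exists_iterate_mem_of_eqOn_compl (S := {x | x ∈ k.word})
    (fun x hx => k.parent_of_notMem hx) k.exists_iterate_mem x
  obtain ⟨j, hj⟩ := iterate_eq_getLast_of_eq_wordNext k.head k.tail k.nodup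
    (fun x hx => k.parent_of_mem hx) _ hi
  exact ⟨j + i, by rw [Function.iterate_add_apply]; exact hj⟩

theorem eq_of_parent_eq {k k' : RootedWord V} (hh : k.head = k'.head)
    (hp : k.parent = k'.parent) : k = k' := by
  have hw : k.word = k'.word := by
    have hnd := k'.nodup
    have hk' : ∀ x ∈ k'.head :: k'.tail, k'.parent x = wordNext (k'.head :: k'.tail) x :=
      fun x hx => k'.parent_of_mem hx
    rw [← hp] at hk'
    rw [← hh] at hnd hk'
    rw [word, word, ← hh, eq_of_eq_wordNext k.head k.tail k'.tail k.nodup hnd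
      (fun x hx => k.parent_of_mem hx) hk']
  refine eq_of_word_eq hw fun x hx => ?_
  rw [← k.parent_of_notMem hx, hp, k'.parent_of_notMem (hw ▸ hx)]

theorem exists_parent_eq {p : V → V} {r : V} (hr : p r = r) (h : ∀ x, ∃ j, p^[j] x = r)
    (t : V) : ∃ k : RootedWord V, k.head = t ∧ k.root = r ∧ k.parent = p := by
  obtain ⟨j, hj⟩ := h t
  obtain ⟨l, hnd, hlast, hp, -⟩ := exists_wordNext_eq hr j t hj
  refine ⟨⟨t, l, hnd, fun x => if x ∈ t :: l then x else p x, fun x hx => if_pos hx, ?_⟩,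
    rfl, hlast, ?_⟩
  · refine exists_iterate_mem_of_eqOn_compl (S := {x | x ∈ t :: l}) (fun x hx => if_neg hx) ?_
    intro x
    obtain ⟨j, hj⟩ := h x
    refine ⟨j, ?_⟩
    rw [hj, ← hlast]
    exact List.getLast_mem _
  · funext x
    by_cases hx : x ∈ t :: l
    · rw [parent_of_mem _ hx]
      exact (hp x hx).symm
    · rw [parent_of_notMem _ hx]
      exact if_neg hx

theorem foataCycles_le_cycleCount [Finite V] (k : RootedWord V) :
    foataCycles k.word ≤ cycleCount k.toMap := by
  have hex : ∀ v ∈ k.word.toFinset.image (cycleMin k.word),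
      ∃ x, x ∈ k.word ∧ cycleMin k.word x = v := by
    simp
  choose! g hg hg' using hex
  rw [foataCycles, cycleCount, ← Set.ncard_coe_finset]
  refine Set.ncard_le_ncard_of_injOn (fun v => {y | ∃ j : ℕ, k.toMap^[j] (g v) = y})
    (fun v hv => ⟨g v, (k.inCore_toMap_iff _).2 (hg v hv), rfl⟩) ?_ (Set.toFinite _)
  intro v hv v' hv' e
  have hmem : g v' ∈ {y | ∃ j : ℕ, k.toMap^[j] (g v) = y} := by
    dsimp only at e
    rw [e]
    exact ⟨0, rfl⟩
  obtain ⟨j, hj⟩ := hmem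
  rw [← hg' v hv, ← hg' v' hv', ← hj, (k.iterate_toMap (hg v hv) j).1]
  clear hj
  induction j with
  | zero => rfl
  | succ j ih => rw [Function.iterate_succ_apply', cycleMin_foata k.word_nodup, ih]

theorem univ_val_map_eq [Fintype V] {β : Type*} (k : RootedWord V) (f : V → β) :
    (Finset.univ : Finset V).val.map f =
      (k.word.map f : Multiset β) + (Finset.univ.filter (· ∉ k.word)).val.map f := by
  have h : (Finset.univ.filter (· ∈ k.word)).val = (k.word : Multiset V) := by
    have hw : k.word.toFinset.val = k.word := by
      rw [List.toFinset_val, List.dedup_eq_self.2 k.word_nodup]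
    rw [← hw]
    congr 1
    ext x
    simp
  rw [← Multiset.map_coe, ← h, ← Multiset.map_add, Finset.filter_val, Finset.filter_val,
    Multiset.filter_add_not]

/-- The doubly rooted tree in which the word is the path between the two roots. -/
def toTree {n : ℕ} (k : RootedWord (Fin n)) : DoublyRootedTree n where
  tree := parentGraph k.parent
  isTree := parentGraph_isTree k.parent_root k.exists_iterate_parent_eq_root
  r1 := k.head
  r2 := k.root

theorem toTree_bijective {n : ℕ} :
    Function.Bijective (toTree : RootedWord (Fin n) → DoublyRootedTree n) := by
  constructor
  · intro k k' e
    have h1 : parentGraph k.parent = parentGraph k'.parent :=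
      congrArg DoublyRootedTree.tree e
    have h2 : k.head = k'.head := congrArg DoublyRootedTree.r1 e
    have h3 : k.root = k'.root := congrArg DoublyRootedTree.r2 e
    exact eq_of_parent_eq h2 (parentGraph_injective k.parent_root (h3 ▸ k'.parent_root)
      k.exists_iterate_parent_eq_root h1)
  · rintro ⟨G, hG, t, r⟩
    obtain ⟨p, hr, h, rfl⟩ := exists_parentGraph_eq hG r
    obtain ⟨k, rfl, rfl, rfl⟩ := exists_parent_eq hr h t
    exact ⟨k, rfl⟩

theorem cons_graphEdges_toTree {n : ℕ} (k : RootedWord (Fin n)) :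
    s(k.root, k.root) ::ₘ graphEdges k.toTree.tree =
      (Finset.univ : Finset (Fin n)).val.map fun x => s(x, k.parent x) := by
  have hinj := injOn_parentEdge k.parent_root k.exists_iterate_parent_eq_root
  have h : k.toTree.tree.edgeSet.toFinite.toFinset =
      (Finset.univ.erase k.root).image fun x => s(x, k.parent x) := by
    ext e
    rw [Set.Finite.mem_toFinset]
    change e ∈ (parentGraph k.parent).edgeSet ↔ _
    rw [parentGraph_edgeSet k.parent_root k.exists_iterate_parent_eq_root]
    simp
  rw [graphEdges, h, Finset.image_val_of_injOn, ← Finset.insert_erase (Finset.mem_univ k.root),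
    Finset.insert_val_of_notMem (Finset.notMem_erase _ _), Multiset.map_cons, k.parent_root,
    Finset.insert_erase (Finset.mem_univ k.root)]
  simpa [Set.InjOn] using hinj

theorem msdCard_add_add_le {α : Type*} (C X Y : Multiset α) :
    msdCard (C + X) (C + Y) ≤ X.card + Y.card := by
  rw [msdCard, add_tsub_add_eq_tsub_left, add_tsub_add_eq_tsub_left, Multiset.card_add]
  exact add_le_add (Multiset.card_le_card tsub_le_self) (Multiset.card_le_card tsub_le_self)

theorem msdCard_toMap_toTree_le {n : ℕ} (k : RootedWord (Fin n)) :
    msdCard (funEdges k.toMap) (graphEdges k.toTree.tree) ≤ 2 * cycleCount k.toMap := by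
  have hrest : ((Finset.univ.filter (· ∉ k.word)).val.map fun x => s(x, k.parent x)) =
      (Finset.univ.filter (· ∉ k.word)).val.map fun x => s(x, k.toMap x) := by
    refine Multiset.map_congr rfl fun x hx => ?_
    have hx : x ∉ k.word := by simpa using hx
    rw [k.parent_of_notMem hx, k.toMap_of_notMem hx]
  obtain ⟨Q, X, Y, hX, hY, hXc, hYc⟩ := foata_edges k.head k.tail k.nodup
  change _ ≤ foataCycles k.word at hXc hYc
  have hT := k.cons_graphEdges_toTree
  have hF : funEdges k.toMap = _ := k.univ_val_map_eq _
  have h1 : (k.word.map fun x => s(x, k.toMap x)) = k.word.map fun x => s(x, foata k.word x) :=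
    List.map_congr_left fun x hx => by rw [k.toMap_of_mem hx]
  have h2 : (k.word.map fun x => s(x, k.parent x)) =
      k.word.map fun x => s(x, wordNext k.word x) :=
    List.map_congr_left fun x hx => by rw [k.parent_of_mem hx]
  rw [h1] at hF
  rw [k.univ_val_map_eq, hrest, h2] at hT
  generalize ((Finset.univ.filter (· ∉ k.word)).val.map fun x => s(x, k.toMap x)) = M at hT hF
  have hX' : (k.word.map fun x => s(x, foata k.word x) : Multiset (Sym2 (Fin n))) =
      s(k.head, foata k.word k.head) ::ₘ (Q + X) := by
    rw [← hX]
    rfl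
  have hT' : graphEdges k.toTree.tree = (Q + M) + Y := by
    refine (Multiset.cons_inj_right s(k.root, k.root)).1 (hT.trans ?_)
    rw [word, hY, Multiset.cons_add, add_right_comm]
    rfl
  have hF' : funEdges k.toMap = (Q + M) + (s(k.head, foata k.word k.head) ::ₘ X) := by
    rw [hF, hX', Multiset.add_cons, Multiset.cons_add, add_right_comm]
  have hc := k.foataCycles_le_cycleCount
  rw [hT', hF']
  refine (msdCard_add_add_le _ _ _).trans ?_
  rw [Multiset.card_cons]
  omega

end RootedWord

theorem exists_bijection_maps_doublyRootedTrees (n : ℕ) (hn : 1 ≤ n) :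
    ∃ R : (Fin n → Fin n) ≃ DoublyRootedTree n,
      ∀ f : Fin n → Fin n,
        msdCard (funEdges f) (graphEdges (R f).tree) ≤ 2 * cycleCount f := by
  have : Nonempty (Fin n) := ⟨⟨0, hn⟩⟩
  let A : RootedWord (Fin n) ≃ (Fin n → Fin n) := Equiv.ofBijective RootedWord.toMap
    ⟨RootedWord.toMap_injective, RootedWord.toMap_surjective⟩
  refine ⟨A.symm.trans (Equiv.ofBijective _ RootedWord.toTree_bijective), fun f => ?_⟩
  obtain ⟨k, rfl⟩ := A.surjective f
  rw [Equiv.trans_apply, Equiv.symm_apply_apply]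
  exact k.msdCard_toMap_toTree_le
end

section
/- (Rényi–Joyal bijection) For every positive integer n there exists a bijection R from the set of all functions f : {1,…,n} → {1,…,n} to the set of doubly rooted trees on n vertices such that for every such f, the symmetric difference of the undirected edge multiset E(f) of the functional graph of f and the edge set of the tree R(f) has size at most 2·c(f) − 1. -/
open scoped Classical

/-- `y` lies in every `f`-invariant set containing `x`, i.e. in the forward orbit of `x`. -/
def Reach {V : Type*} (f : V → V) (x y : V) : Prop :=
  ∀ S : Set V, x ∈ S → (∀ z ∈ S, f z ∈ S) → y ∈ S

/-- Every forward orbit of `f` meets `M`. -/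
def Attracts {V : Type*} (f : V → V) (M : Set V) : Prop :=
  ∀ S : Set V, M ⊆ S → (∀ x, f x ∈ S → x ∈ S) → ∀ x, x ∈ S

theorem reach_iff {V : Type*} {f : V → V} {x y : V} : Reach f x y ↔ ∃ j : ℕ, f^[j] x = y := by
  constructor
  · intro h
    refine h {z | ∃ j : ℕ, f^[j] x = z} ⟨0, rfl⟩ ?_
    rintro z ⟨j, rfl⟩
    exact ⟨j + 1, Function.iterate_succ_apply' f j x⟩
  · rintro ⟨j, rfl⟩ S hx hS
    induction j with
    | zero => exact hx
    | succ j ih => rw [Function.iterate_succ_apply']; exact hS _ ih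

theorem Reach.refl {V : Type*} (f : V → V) (x : V) : Reach f x x := fun _ h _ => h

theorem Reach.map {V : Type*} {f : V → V} {x y : V} (h : Reach f x y) : Reach f x (f y) :=
  fun S hx hS => hS _ (h S hx hS)

theorem attracts_iff {V : Type*} {f : V → V} {M : Set V} :
    Attracts f M ↔ ∀ x, ∃ j : ℕ, f^[j] x ∈ M := by
  constructor
  · intro h
    refine h {x | ∃ j : ℕ, f^[j] x ∈ M} (fun x hx => ⟨0, hx⟩) ?_
    rintro x ⟨j, hj⟩
    exact ⟨j + 1, hj⟩
  · intro h S hM hS x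
    obtain ⟨j, hj⟩ := h x
    induction j generalizing x with
    | zero => exact hM hj
    | succ j ih => exact hS _ (ih _ hj)

theorem Attracts.mono {V : Type*} {f : V → V} {M N : Set V} (h : Attracts f M) (hMN : M ⊆ N) :
    Attracts f N := fun S hN hS => h S (hMN.trans hN) hS

theorem iterate_eq_of_fixed {V : Type*} {f : V → V} {r : V} (hr : f r = r) (j : ℕ) :
    f^[j] r = r := Function.iterate_fixed hr j

/-- If all orbits end in the fixed point `r`, then `r` is the only periodic point. -/
theorem eq_of_periodic {V : Type*} {f : V → V} {r : V} (hr : f r = r) (h : Attracts f {r})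
    {x : V} {j : ℕ} (hj : 0 < j) (hx : f^[j] x = x) : x = r := by
  obtain ⟨i, hi⟩ := attracts_iff.1 h x
  have h1 : f^[j * i] x = x := by
    rw [Function.iterate_mul]
    exact Function.iterate_fixed hx i
  have h2 : j * i = (j * i - i) + i := by
    have : i ≤ j * i := Nat.le_mul_of_pos_left i hj
    omega
  rw [h2, Function.iterate_add_apply, Set.mem_singleton_iff.1 hi, iterate_eq_of_fixed hr] at h1
  exact h1.symm

/-- A linear arrangement of `α`, coded by its first point and its successor map, where the last
point is fixed. -/
def Arrangement (α : Type*) : Type _ :=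
  {t : (α → α) × α // (∃ r, t.1 r = r) ∧ ∀ x, Reach t.1 t.2 x}

namespace Arrangement

variable {α : Type*}

theorem attracts (t : Arrangement α) {r : α} (hr : t.1.1 r = r) : Attracts t.1.1 {r} := by
  rw [attracts_iff]
  intro x
  obtain ⟨i, hi⟩ := reach_iff.1 (t.2.2 x)
  obtain ⟨j, hj⟩ := reach_iff.1 (t.2.2 r)
  refine ⟨j, ?_⟩
  rw [Set.mem_singleton_iff, ← hi, ← Function.iterate_add_apply, Nat.add_comm,
    Function.iterate_add_apply, hj, iterate_eq_of_fixed hr]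

theorem fixed_unique (t : Arrangement α) {x y : α} (hx : t.1.1 x = x) (hy : t.1.1 y = y) :
    x = y :=
  eq_of_periodic hy (t.attracts hy) Nat.one_pos hx

theorem two_cycle (t : Arrangement α) {x y : α} (hx : t.1.1 x = y) (hy : t.1.1 y = x) :
    x = y := by
  obtain ⟨r, hr⟩ := t.2.1
  have h : x = r := eq_of_periodic hr (t.attracts hr) Nat.two_pos (by
    simp [Function.iterate_succ_apply, hx, hy])
  rw [h, hr] at hx
  rw [h, hx]

theorem eq_of_map_eq_first (t : Arrangement α) {u : α} (hu : t.1.1 u = t.1.2) (x : α) :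
    x = t.1.2 := by
  obtain ⟨r, hr⟩ := t.2.1
  obtain ⟨j, hj⟩ := reach_iff.1 (t.2.2 u)
  have h : t.1.2 = r := eq_of_periodic hr (t.attracts hr) (Nat.succ_pos j) (by
    rw [Function.iterate_succ_apply', hj, hu])
  obtain ⟨i, hi⟩ := reach_iff.1 (t.2.2 x)
  rw [← hi, h, iterate_eq_of_fixed hr]

theorem map_eq_map (t : Arrangement α) {u v : α} (huv : t.1.1 u = t.1.1 v) :
    u = v ∨ t.1.1 u = u ∨ t.1.1 v = v := by
  obtain ⟨r, hr⟩ := t.2.1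
  obtain ⟨i, hi⟩ := reach_iff.1 (t.2.2 u)
  obtain ⟨j, hj⟩ := reach_iff.1 (t.2.2 v)
  have key : ∀ (u v : α) (i d : ℕ), t.1.1 u = t.1.1 v → t.1.1^[i] t.1.2 = u →
      t.1.1^[i + (d + 1)] t.1.2 = v → t.1.1 v = v := by
    intro u v i d huv hi hj
    have h1 : t.1.1^[d] (t.1.1 u) = v := by
      rw [← hj, ← hi, Nat.add_comm, Function.iterate_add_apply, Function.iterate_succ_apply]
    have h2 : t.1.1 u = r := eq_of_periodic hr (t.attracts hr) (Nat.succ_pos d) (by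
      rw [Function.iterate_succ_apply', h1, huv])
    rw [h2, iterate_eq_of_fixed hr] at h1
    rw [← h1, hr]
  rcases lt_trichotomy i j with h | h | h
  · obtain ⟨d, rfl⟩ := Nat.exists_eq_add_of_lt h
    exact .inr (.inr (key u v i d huv hi hj))
  · left; rw [← hi, ← hj, h]
  · obtain ⟨d, rfl⟩ := Nat.exists_eq_add_of_lt h
    exact .inr (.inl (key v u j d huv.symm hj hi))

/-- The successor map after inserting `none` in front of `i`, or at the end if `i = none`. -/
noncomputable def insertMap (i : Option α) (s : α → α) : Option α → Option α
  | none => i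
  | some x => if (i = some (s x) ∧ s x ≠ x) ∨ (i = none ∧ s x = x) then none else some (s x)

/-- Insert `none` in front of `i`, or at the end if `i = none`. -/
noncomputable def insert (i : Option α) (t : Arrangement α) : Arrangement (Option α) :=
  ⟨(insertMap i t.1.1, if i = some t.1.2 then none else some t.1.2), by
    obtain ⟨⟨s, a⟩, ⟨r, hr⟩, ha⟩ := t
    dsimp only at hr ha ⊢
    refine ⟨?_, ?_⟩
    · rcases i with _ | i
      · exact ⟨none, rfl⟩
      · exact ⟨some r, by simp [insertMap, hr]⟩
    · intro z S h0 hS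
      have hsome : ∀ x, some x ∈ S := by
        intro x
        refine ha x {y | some y ∈ S} ?_ ?_
        · by_cases h : i = some a
          · rw [if_pos h] at h0
            have := hS _ h0
            simpa [insertMap, h] using this
          · rwa [if_neg h] at h0
        · intro y (hy : some y ∈ S)
          have h1 := hS _ hy
          change some (s y) ∈ S
          simp only [insertMap] at h1
          split_ifs at h1 with hc
          · rcases hc with ⟨hc, -⟩ | ⟨-, hc⟩
            · have := hS _ h1
              simpa [insertMap, hc] using this
            · rwa [hc]
          · exact h1
      rcases z with _ | z
      · by_contra hn
        rcases i with _ | i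
        · have := hS _ (hsome r)
          simp [insertMap, hr, hn] at this
        · have h := ha i {x | x ≠ i} (by rintro rfl; simp [hn] at h0) (by
            intro x hx hxi
            have := hS _ (hsome x)
            simp only [insertMap, hxi, ne_eq, true_and] at this
            rw [if_pos (Or.inl (fun h => hx h.symm))] at this
            exact hn this)
          exact h rfl
      · exact hsome z⟩

/-- The successor map after deleting `none`. -/
def deleteMap (s : Option α → Option α) (x : α) : α :=
  (s (some x)).getD ((s none).getD x)

/-- Delete `none`. -/
noncomputable def delete [Nonempty α] (t : Arrangement (Option α)) : Arrangement α :=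
  ⟨(deleteMap t.1.1, t.1.2.getD ((t.1.1 none).getD (Classical.arbitrary α))), by
    obtain ⟨⟨s, a⟩, ⟨r, hr⟩, ha⟩ := t
    dsimp only at hr ha ⊢
    refine ⟨?_, ?_⟩
    · rcases r with _ | r
      · by_contra hn
        push Not at hn
        have h1 : ∀ x, s (some x) ≠ none := by
          intro x hx
          exact hn x (by simp [deleteMap, hx, hr])
        have h2 : a ≠ none := by
          rintro rfl
          have := ha (some (Classical.arbitrary α)) {none} rfl (by simp [hr])
          simp at this
        exact ha none {x | x ≠ none} h2 (by
          rintro (_ | x) hx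
          · exact absurd rfl hx
          · exact h1 x) rfl
      · exact ⟨r, by simp [deleteMap, hr]⟩
    · intro z S h0 hS
      refine ha (some z) {x | (∀ y, x = some y → y ∈ S) ∧
        (x = none → ∀ i, s none = some i → i ∈ S)} ?_ ?_ |>.1 z rfl
      · rcases a with _ | a
        · refine ⟨by simp, ?_⟩
          intro _ i hi
          simpa [hi] using h0
        · refine ⟨?_, by simp⟩
          simpa using h0
      · rintro (_ | x) ⟨hx1, hx2⟩
        · refine ⟨hx2 rfl, fun h i hi => ?_⟩
          rw [h] at hi; simp at hi
        · have := hS _ (hx1 x rfl)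
          refine ⟨fun y hy => ?_, fun h i hi => ?_⟩
          · simpa [deleteMap, hy] using this
          · simpa [deleteMap, h, hi] using this⟩

theorem delete_insert [Nonempty α] (i : Option α) (t : Arrangement α) :
    (t.insert i).delete = t := by
  apply Subtype.ext
  apply Prod.ext
  · funext x
    change deleteMap (insertMap i t.1.1) x = t.1.1 x
    simp only [deleteMap, insertMap]
    split_ifs with h
    · rcases h with ⟨h, -⟩ | ⟨h, h'⟩
      · simp [h]
      · simp [h, h']
    · rfl
  · change (if i = some t.1.2 then none else some t.1.2).getD (i.getD _) = t.1.2
    split_ifs with h <;> simp [h]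

theorem insert_delete [Nonempty α] (t : Arrangement (Option α)) :
    t.delete.insert (t.1.1 none) = t := by
  apply Subtype.ext
  apply Prod.ext
  · funext x
    change insertMap (t.1.1 none) (deleteMap t.1.1) x = t.1.1 x
    rcases x with _ | x
    · rfl
    · rcases hx : t.1.1 (some x) with _ | y
      · rcases hn : t.1.1 none with _ | i
        · simp [insertMap, deleteMap, hx, hn]
        · have : i ≠ x := by
            rintro rfl
            exact absurd (t.two_cycle hx hn) (by simp)
          simp [insertMap, deleteMap, hx, hn, this]
      · simp only [insertMap, deleteMap, hx, Option.getD_some]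
        rw [if_neg]
        rintro (⟨h1, h2⟩ | ⟨h1, h2⟩)
        · rcases t.map_eq_map (hx.trans h1.symm) with h | h | h
          · simp at h
          · rw [hx] at h; exact h2 (by simpa using h)
          · rw [h1] at h; simp at h
        · subst h2
          exact absurd (t.fixed_unique hx h1) (by simp)
  · change (if t.1.1 none = some (t.1.2.getD ((t.1.1 none).getD _)) then none
      else some (t.1.2.getD ((t.1.1 none).getD _))) = t.1.2
    rcases ha : t.1.2 with _ | a
    · rcases hn : t.1.1 none with _ | i
      · have := t.2.2 (some (Classical.arbitrary α)) {none} (by simp [ha]) (by simp [hn])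
        simp at this
      · simp
    · simp only [Option.getD_some]
      rw [if_neg]
      intro h
      have := t.eq_of_map_eq_first (h.trans ha.symm) none
      rw [ha] at this
      simp at this

/-- Arrangements of `Option α` are arrangements of `α` with a place to insert `none`. -/
noncomputable def optionEquiv [Nonempty α] :
    Option α × Arrangement α ≃ Arrangement (Option α) where
  toFun p := p.2.insert p.1
  invFun t := (t.1.1 none, t.delete)
  left_inv p := Prod.ext rfl (delete_insert p.1 p.2)
  right_inv t := insert_delete t

/-- Transport an arrangement along an equivalence. -/
def transport {β : Type*} (e : α ≃ β) (t : Arrangement α) : Arrangement β :=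
  ⟨(e ∘ t.1.1 ∘ e.symm, e t.1.2), by
    obtain ⟨⟨s, a⟩, ⟨r, hr⟩, ha⟩ := t
    dsimp only at hr ha ⊢
    refine ⟨⟨e r, by simp [hr]⟩, fun x S h0 hS => ?_⟩
    have := ha (e.symm x) (e ⁻¹' S) h0 (fun z hz => by simpa using hS _ hz)
    simpa using this⟩

/-- Arrangements of equivalent types correspond. -/
def congr {β : Type*} (e : α ≃ β) : Arrangement α ≃ Arrangement β where
  toFun := transport e
  invFun := transport e.symm
  left_inv t := by
    apply Subtype.ext
    apply Prod.ext
    · funext x; simp [transport]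
    · simp [transport]
  right_inv t := by
    apply Subtype.ext
    apply Prod.ext
    · funext x; simp [transport]
    · simp [transport]

end Arrangement

/-- The arc of `f` at `x` is broken when passing to `s`: either `x` is a fixed point of `s`, or
`f` and `s` differ at `x`. -/
def Broken {α : Type*} (f s : α → α) (x : α) : Prop := s x = x ∨ f x ≠ s x

/-- Each cycle of `f` has at most one broken arc. -/
def FewBroken {α : Type*} (f s : α → α) : Prop :=
  ∀ x y, Broken f s x → Broken f s y → Reach f x y → x = y

theorem fewBroken_insert {α : Type*} (i : Option α) (σ : Equiv.Perm α) (t : Arrangement α)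
    (h : FewBroken σ t.1.1) :
    FewBroken (Equiv.Perm.decomposeOption.symm (i, σ)) (t.insert i).1.1 := by
  set τ : Equiv.Perm (Option α) := Equiv.Perm.decomposeOption.symm (i, σ) with hτ
  have τnone : τ none = i := by simp [hτ]
  have τsome : ∀ x, τ (some x) = if i = some (σ x) then none else some (σ x) := by
    intro x
    simp only [hτ, Equiv.Perm.decomposeOption_symm_apply, Equiv.Perm.mul_apply,
      Equiv.optionCongr_apply, Option.map_some, Equiv.swap_apply_def]
    simp [eq_comm]
  have bsome : ∀ x, Broken τ (t.insert i).1.1 (some x) → Broken σ t.1.1 x := by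
    intro x hx
    by_contra hc
    simp only [Broken, not_or, not_not] at hc
    simp only [Broken, τsome, hc.2, Arrangement.insert, Arrangement.insertMap, hc.1, ne_eq,
      not_false_eq_true, and_true, and_false, or_false, not_true_eq_false] at hx
    split_ifs at hx
    all_goals simp_all
  have bnone : Broken τ (t.insert i).1.1 none → i = none := by
    simp [Broken, τnone, Arrangement.insert, Arrangement.insertMap]
  rintro (_ | x) (_ | y) hx hy hxy
  · rfl
  · have := hxy {none} rfl (by simp [τnone, bnone hx])
    simp at this
  · exfalso
    exact hxy {z | z ≠ none} (by simp) (by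
      rintro (_ | z) hz
      · exact absurd rfl hz
      · simp [τsome, bnone hy]) rfl
  · congr 1
    refine h x y (bsome x hx) (bsome y hy) ?_
    intro S h0 hS
    refine (hxy {z | (∀ w, z = some w → w ∈ S) ∧ (z = none → ∀ w, i = some w → w ∈ S)} ?_ ?_).1
      y rfl
    · exact ⟨by simpa using h0, by simp⟩
    · rintro (_ | z) ⟨h1, h2⟩
      · rw [τnone]
        exact ⟨h2 rfl, fun h w hw => by simp [h] at hw⟩
      · have hz := hS _ (h1 z rfl)
        rw [τsome]
        split_ifs with hc
        · refine ⟨by simp, fun _ w hw => ?_⟩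
          rw [hc] at hw
          simp only [Option.some.injEq] at hw
          rwa [← hw]
        · exact ⟨by simpa using hz, by simp⟩

/-- Permutations correspond to arrangements, breaking at most one arc in each cycle. -/
theorem exists_perm_equiv_arrangement (α : Type*) [Finite α] : Nonempty α →
    ∃ e : Equiv.Perm α ≃ Arrangement α, ∀ σ : Equiv.Perm α, FewBroken σ (e σ).1.1 := by
  induction α using Finite.induction_empty_option with
  | of_equiv φ ih =>
    intro hne
    obtain ⟨e, he⟩ := ih (φ.nonempty_congr.2 hne)
    refine ⟨φ.symm.permCongr.trans (e.trans (Arrangement.congr φ)), fun σ x y hx hy hxy => ?_⟩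
    apply φ.symm.injective
    have hb : ∀ x, Broken σ (Arrangement.congr φ (e (φ.symm.permCongr σ))).1.1 x →
        Broken (φ.symm.permCongr σ) (e (φ.symm.permCongr σ)).1.1 (φ.symm x) := by
      intro x hx
      rcases hx with hx | hx
      · change φ ((e (φ.symm.permCongr σ)).1.1 (φ.symm x)) = x at hx
        exact .inl (φ.injective (by rw [hx, φ.apply_symm_apply]))
      · right
        intro h
        apply hx
        change _ = φ ((e (φ.symm.permCongr σ)).1.1 (φ.symm x))
        rw [← h]
        simp [Equiv.permCongr_apply]
    refine he _ _ _ (hb x hx) (hb y hy) ?_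
    intro S h0 hS
    refine hxy (φ.symm ⁻¹' S) h0 (fun z hz => ?_)
    simpa [Equiv.permCongr_apply] using hS _ hz
  | h_empty => rintro ⟨⟨⟩⟩
  | @h_option α _ ih =>
    intro _
    cases isEmpty_or_nonempty α with
    | inl h =>
      refine ⟨⟨fun _ => ⟨(id, none), ⟨none, rfl⟩, fun x => ?_⟩, fun _ => 1, fun _ => ?_,
        fun _ => ?_⟩, fun σ x y _ _ _ => Subsingleton.elim _ _⟩
      · rw [Subsingleton.elim x none]; exact Reach.refl _ _
      · exact Subsingleton.elim _ _
      · exact Subtype.ext (Subsingleton.elim _ _)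
    | inr h =>
      obtain ⟨e, he⟩ := ih h
      refine ⟨Equiv.Perm.decomposeOption.trans
        ((Equiv.prodCongr (Equiv.refl _) e).trans Arrangement.optionEquiv), fun σ => ?_⟩
      have := fewBroken_insert (Equiv.Perm.decomposeOption σ).1 _ _
        (he (Equiv.Perm.decomposeOption σ).2)
      rw [Prod.mk.eta, Equiv.symm_apply_apply] at this
      exact this

/-- A self-map all of whose orbits end in a single fixed point, with a marked point. -/
def RootedMap (V : Type*) : Type _ :=
  {t : (V → V) × V // ∃ r, t.1 r = r ∧ Attracts t.1 {r}}

/-- The set of periodic points of `f`. -/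
def coreSet {V : Type*} (f : V → V) : Set V := {x | inCore f x}

/-- Replace `f` on `M` by `s`. -/
noncomputable def glue {V : Type*} (M : Set V) (s : M → M) (f : V → V) (x : V) : V :=
  if h : x ∈ M then s ⟨x, h⟩ else f x

section Glue

variable {V : Type*} {M : Set V}

@[simp] theorem glue_coe (s : M → M) (f : V → V) (x : M) : glue M s f x = s x := by
  simp [glue]

theorem glue_of_notMem (s : M → M) (f : V → V) {x : V} (h : x ∉ M) : glue M s f x = f x := by
  simp [glue, h]

theorem mapsTo_glue (s : M → M) (f : V → V) : Set.MapsTo (glue M s f) M M := by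
  intro x hx
  lift x to M using hx
  simp

theorem glue_eq_self (s : M → M) (f g : V → V) (h : ∀ x : M, (s x : V) = f x)
    (hg : ∀ x ∉ M, g x = f x) : glue M s g = f := by
  funext x
  by_cases hx : x ∈ M
  · lift x to M using hx
    rw [glue_coe, h]
  · rw [glue_of_notMem s g hx, hg x hx]

theorem attracts_glue (s : M → M) {f : V → V} (h : Attracts f M) : Attracts (glue M s f) M := by
  intro S hM hS
  refine h S hM (fun x hx => ?_)
  by_cases hxM : x ∈ M
  · exact hM hxM
  · exact hS x (by rwa [glue_of_notMem s f hxM])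

theorem coreSet_eq [Finite V] {f : V → V} (h : Attracts f M) (hM : Set.MapsTo f M M)
    (hi : Set.InjOn f M) : coreSet f = M := by
  ext x
  constructor
  · rintro ⟨j, hj, hx⟩
    obtain ⟨i, hi⟩ := attracts_iff.1 h x
    have h1 : f^[j * i] x = x := by
      rw [Function.iterate_mul]
      exact Function.iterate_fixed hx i
    have h2 : j * i = (j * i - i) + i := by
      have : i ≤ j * i := Nat.le_mul_of_pos_left i hj
      omega
    rw [h2, Function.iterate_add_apply] at h1
    rw [← h1]
    exact hM.iterate _ hi
  · intro hx
    obtain ⟨j, hj, hp⟩ := (hM.restrict_inj.2 hi).mem_periodicPts ⟨x, hx⟩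
    refine ⟨j, hj, ?_⟩
    have := congrArg Subtype.val hp
    rwa [hM.iterate_restrict] at this

theorem bijOn_coreSet {f : V → V} (hM : coreSet f = M) : Set.BijOn f M M := by
  subst hM
  exact Function.bijOn_periodicPts f

theorem attracts_coreSet [Finite V] {f : V → V} (hM : coreSet f = M) : Attracts f M := by
  subst hM
  rw [attracts_iff]
  intro x
  obtain ⟨i, j, hij, h⟩ := Finite.exists_ne_map_eq_of_infinite (fun j : ℕ => f^[j] x)
  wlog hlt : i < j generalizing i j
  · exact this j i hij.symm h.symm (by omega)
  refine ⟨i, j - i, by omega, ?_⟩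
  rw [← Function.iterate_add_apply, Nat.sub_add_cancel hlt.le]
  exact h.symm

theorem coreSet_nonempty [Finite V] [Nonempty V] (f : V → V) : (coreSet f).Nonempty := by
  obtain ⟨j, hj⟩ := attracts_iff.1 (attracts_coreSet (f := f) rfl) (Classical.arbitrary V)
  exact ⟨_, hj⟩

/-- The forward orbit of the marked point. -/
def RootedMap.spine (t : RootedMap V) : Set V := {y | Reach t.1.1 t.1.2 y}

theorem RootedMap.mapsTo_spine (t : RootedMap V) : Set.MapsTo t.1.1 t.spine t.spine :=
  fun _ hx => Reach.map hx

theorem RootedMap.mem_spine (t : RootedMap V) : t.1.2 ∈ t.spine := Reach.refl _ _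

theorem RootedMap.root_mem_spine (t : RootedMap V) {r : V} (h : Attracts t.1.1 {r}) :
    r ∈ t.spine := by
  obtain ⟨j, hj⟩ := attracts_iff.1 h t.1.2
  exact reach_iff.2 ⟨j, hj⟩

theorem RootedMap.attracts_spine (t : RootedMap V) (hM : t.spine = M) : Attracts t.1.1 M := by
  subst hM
  obtain ⟨r, -, h⟩ := t.2
  exact h.mono (Set.singleton_subset_iff.2 (t.root_mem_spine h))

/-- The arrangement of the spine of a rooted map. -/
def RootedMap.arrangement (t : RootedMap V) (h : t.spine = M) : Arrangement M :=
  ⟨((h ▸ t.mapsTo_spine : Set.MapsTo t.1.1 M M).restrict, ⟨t.1.2, h ▸ t.mem_spine⟩), by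
    subst h
    obtain ⟨r, hr, ha⟩ := t.2
    refine ⟨⟨⟨r, t.root_mem_spine ha⟩, Subtype.ext hr⟩, ?_⟩
    rintro ⟨x, hx⟩ S h0 hS
    have := hx (Subtype.val '' S) ⟨_, h0, rfl⟩ (by
      rintro _ ⟨z, hz, rfl⟩
      exact ⟨_, hS z hz, rfl⟩)
    obtain ⟨_, hy, rfl⟩ := this
    exact hy⟩

/-- Follow an arrangement of `M` inside `M` and `f` outside. -/
noncomputable def Arrangement.toRootedMap (t : Arrangement M) {f : V → V} (hf : Attracts f M) :
    RootedMap V :=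
  ⟨(glue M t.1.1 f, t.1.2), by
    obtain ⟨r, hr⟩ := t.2.1
    refine ⟨r, by simp [hr], fun S h0 hS => attracts_glue t.1.1 hf S (fun x hx => ?_) hS⟩
    refine t.attracts hr (Subtype.val ⁻¹' S) (by simpa using h0) (fun z hz => ?_) ⟨x, hx⟩
    exact hS z (by simpa using hz)⟩

theorem Arrangement.spine_toRootedMap (t : Arrangement M) {f : V → V} (hf : Attracts f M) :
    (t.toRootedMap hf).spine = M := by
  ext x
  constructor
  · intro hx
    exact hx M t.1.2.2 (fun z hz => mapsTo_glue _ _ hz)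
  · intro hx S h0 hS
    refine t.2.2 ⟨x, hx⟩ (Subtype.val ⁻¹' S) h0 (fun z hz => ?_)
    have := hS z hz
    simpa [toRootedMap] using this

/-- Maps with core `M` correspond to rooted maps with spine `M`. -/
noncomputable def fiberEquiv [Finite V] (e : Equiv.Perm M ≃ Arrangement M) :
    {f : V → V // coreSet f = M} ≃ {t : RootedMap V // t.spine = M} where
  toFun f := ⟨(e ((bijOn_coreSet f.2).equiv f.1)).toRootedMap (attracts_coreSet f.2),
    Arrangement.spine_toRootedMap _ _⟩
  invFun t := ⟨glue M (e.symm (t.1.arrangement t.2)) t.1.1.1, by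
    refine coreSet_eq (attracts_glue _ (t.1.attracts_spine t.2)) (mapsTo_glue _ _) ?_
    intro x hx y hy hxy
    lift x to M using hx
    lift y to M using hy
    simpa [Subtype.val_inj] using hxy⟩
  left_inv f := by
    obtain ⟨f, hf⟩ := f
    apply Subtype.ext
    dsimp only
    have h : Set.BijOn f M M := bijOn_coreSet hf
    have key : ∀ (ha : Attracts f M) (hs),
        ((e (h.equiv f)).toRootedMap ha).arrangement hs = e (h.equiv f) := by
      intro ha hs
      apply Subtype.ext
      apply Prod.ext
      · funext x
        exact Subtype.ext (glue_coe _ _ x)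
      · rfl
    rw [key, Equiv.symm_apply_apply]
    exact glue_eq_self _ _ _ (fun x => rfl) (fun x hx => glue_of_notMem _ _ hx)
  right_inv t := by
    obtain ⟨t, ht⟩ := t
    apply Subtype.ext
    apply Subtype.ext
    dsimp only
    have key : ∀ (σ : Equiv.Perm M) (h : Set.BijOn (glue M σ t.1.1) M M),
        h.equiv (glue M σ t.1.1) = σ := by
      intro σ h
      ext x
      exact glue_coe _ _ x
    rw [key, Equiv.apply_symm_apply]
    apply Prod.ext
    · exact glue_eq_self _ _ _ (fun x => rfl) (fun x hx => glue_of_notMem _ _ hx)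
    · rfl

theorem broken_fiberEquiv [Finite V] (e : Equiv.Perm M ≃ Arrangement M)
    (f : {f : V → V // coreSet f = M}) {x : V} (hx : Broken f.1 (fiberEquiv e f).1.1.1 x) :
    x ∈ M := by
  by_contra hxM
  have h1 : (fiberEquiv e f).1.1.1 x = f.1 x := glue_of_notMem _ _ hxM
  rcases hx with hx | hx
  · rw [h1] at hx
    apply hxM
    rw [← f.2]
    exact ⟨1, le_rfl, hx⟩
  · exact hx h1.symm

theorem fewBroken_fiberEquiv [Finite V] {e : Equiv.Perm M ≃ Arrangement M}
    (he : ∀ σ : Equiv.Perm M, FewBroken σ (e σ).1.1) (f : {f : V → V // coreSet f = M}) :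
    FewBroken f.1 (fiberEquiv e f).1.1.1 := by
  have h : Set.BijOn f.1 M M := bijOn_coreSet f.2
  have key : ∀ x : M, Broken f.1 (fiberEquiv e f).1.1.1 x →
      Broken (h.equiv f.1) (e (h.equiv f.1)).1.1 x := by
    intro x hx
    have h1 : (fiberEquiv e f).1.1.1 x = (e (h.equiv f.1)).1.1 x := glue_coe _ _ x
    rw [Broken, h1] at hx
    exact hx.imp (fun h => Subtype.ext h) (fun h h' => h (congrArg Subtype.val h'))
  intro x y hx hy hxy
  have hxM := broken_fiberEquiv e f hx
  have hyM := broken_fiberEquiv e f hy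
  refine congrArg Subtype.val (he _ ⟨x, hxM⟩ ⟨y, hyM⟩ (key ⟨x, hxM⟩ hx) (key ⟨y, hyM⟩ hy) ?_)
  intro S h0 hS
  have := hxy (Subtype.val '' S) ⟨_, h0, rfl⟩ (by
    rintro _ ⟨z, hz, rfl⟩
    exact ⟨_, hS z hz, rfl⟩)
  simpa [hyM] using this

end Glue

theorem exists_equiv_rootedMap (V : Type*) [Finite V] [Nonempty V] :
    ∃ R : (V → V) ≃ RootedMap V, ∀ f, FewBroken f (R f).1.1 ∧
      ∀ x, Broken f (R f).1.1 x → inCore f x := by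
  have hex : ∀ M : Set V, ∃ e : {f : V → V // coreSet f = M} ≃ {t : RootedMap V // t.spine = M},
      ∀ f, FewBroken f.1 (e f).1.1.1 ∧ ∀ x, Broken f.1 (e f).1.1.1 x → x ∈ M := by
    intro M
    rcases M.eq_empty_or_nonempty with rfl | hM
    · have h1 : IsEmpty {f : V → V // coreSet f = ∅} :=
        ⟨fun f => (coreSet_nonempty f.1).ne_empty f.2⟩
      have h2 : IsEmpty {t : RootedMap V // t.spine = ∅} :=
        ⟨fun t => (Set.nonempty_of_mem t.1.mem_spine).ne_empty t.2⟩
      exact ⟨Equiv.equivOfIsEmpty _ _, fun f => h1.elim f⟩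
    · obtain ⟨e, he⟩ := exists_perm_equiv_arrangement M hM.to_subtype
      exact ⟨fiberEquiv e, fun f =>
        ⟨fewBroken_fiberEquiv he f, fun x hx => broken_fiberEquiv e f hx⟩⟩
  choose e he using hex
  refine ⟨(Equiv.sigmaFiberEquiv coreSet).symm.trans
    ((Equiv.sigmaCongrRight e).trans (Equiv.sigmaFiberEquiv RootedMap.spine)), fun f => ?_⟩
  exact he (coreSet f) ⟨f, rfl⟩

/-- The simple graph with an edge between `x` and `g x` for every `x` not fixed by `g`. -/
def mapGraph {V : Type*} (g : V → V) : SimpleGraph V where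
  Adj x y := x ≠ y ∧ (g x = y ∨ g y = x)
  symm := ⟨fun _ _ h => ⟨h.1.symm, h.2.symm⟩⟩
  loopless := ⟨fun _ h => h.1 rfl⟩

section MapGraph

variable {V : Type*} {g : V → V} {r : V}

theorem eq_of_map_map (hr : g r = r) (h : Attracts g {r}) {x : V} (hx : g (g x) = x) : x = r :=
  eq_of_periodic hr h (j := 2) Nat.two_pos hx

theorem map_ne (hr : g r = r) (h : Attracts g {r}) {x : V} (hx : x ≠ r) : g x ≠ x :=
  fun h' => hx (eq_of_periodic hr h (j := 1) Nat.one_pos h')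

theorem mapGraph_connected (h : Attracts g {r}) : (mapGraph g).Connected := by
  have key : ∀ x, (mapGraph g).Reachable x r := by
    refine h {x | (mapGraph g).Reachable x r} ?_ ?_
    · rintro _ rfl
      exact SimpleGraph.Reachable.refl _
    · intro x (hx : (mapGraph g).Reachable (g x) r)
      by_cases hgx : g x = x
      · rwa [hgx] at hx
      · exact (SimpleGraph.Adj.reachable (G := mapGraph g) ⟨Ne.symm hgx, .inl rfl⟩).trans hx
  exact (SimpleGraph.connected_iff _).2 ⟨fun x y => (key x).trans (key y).symm, ⟨r⟩⟩

theorem injOn_edge (hr : g r = r) (h : Attracts g {r}) :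
    Set.InjOn (fun x => s(x, g x)) {x | x ≠ r} := by
  intro x hx y _ hxy
  rcases Sym2.eq_iff.1 hxy with ⟨h1, -⟩ | ⟨h1, h2⟩
  · exact h1
  · exact absurd (eq_of_map_map hr h (by rw [h2, ← h1])) hx

theorem mapGraph_isTree [Finite V] (hr : g r = r) (h : Attracts g {r}) :
    (mapGraph g).IsTree := by
  have hc := mapGraph_connected h
  refine SimpleGraph.isTree_iff_connected_and_card.2
    ⟨hc, le_antisymm ?_ hc.card_vert_le_card_edgeSet_add_one⟩
  have hsub : (mapGraph g).edgeSet ⊆ (fun x => s(x, g x)) '' {x | x ≠ r} := by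
    intro z
    induction z using Sym2.ind with
    | _ x y =>
      rintro ⟨hne, h1 | h1⟩
      · refine ⟨x, ?_, by simp [h1]⟩
        rintro rfl
        exact hne (hr.symm.trans h1)
      · refine ⟨y, ?_, by simp [h1, Sym2.eq_swap]⟩
        rintro rfl
        exact hne (h1.symm.trans hr)
  have h1 := (Set.ncard_le_ncard hsub (Set.toFinite _)).trans
    (Set.ncard_image_le (Set.toFinite _))
  have h2 := Set.ncard_add_ncard_compl ({r} : Set V)
  rw [Set.ncard_singleton] at h2
  change (mapGraph g).edgeSet.ncard + 1 ≤ _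
  change _ ≤ ({r}ᶜ : Set V).ncard at h1
  omega

theorem mapGraph_injective {g' : V → V} (hr : g r = r) (h : Attracts g {r}) (hr' : g' r = r)
    (hgg : mapGraph g = mapGraph g') : g = g' := by
  funext x
  refine h {x | g x = g' x} ?_ ?_ x
  · rintro _ rfl
    exact hr.trans hr'.symm
  · intro x (hx : g (g x) = g' (g x))
    change g x = g' x
    by_cases hxr : x = r
    · rw [hxr, hr, hr']
    have hadj : (mapGraph g).Adj x (g x) := ⟨(map_ne hr h hxr).symm, .inl rfl⟩
    rw [hgg] at hadj
    rcases hadj.2 with h1 | h1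
    · exact h1.symm
    · exact absurd (eq_of_map_map hr h (hx.trans h1)) hxr

theorem exists_mapGraph_eq [Finite V] {T : SimpleGraph V} (hT : T.IsTree) (r : V) :
    ∃ g : V → V, g r = r ∧ Attracts g {r} ∧ mapGraph g = T := by
  have hex : ∀ x, ∃ y, (x = r → y = r) ∧ (x ≠ r → T.Adj x y ∧ T.dist y r < T.dist x r) := by
    intro x
    by_cases hx : x = r
    · exact ⟨r, fun _ => rfl, fun h => absurd hx h⟩
    · obtain ⟨p, hp⟩ := hT.connected.exists_walk_length_eq_dist x r
      cases p with
      | nil => exact absurd rfl hx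
      | @cons _ y _ hxy q =>
        refine ⟨y, fun h => absurd h hx, fun _ => ⟨hxy, ?_⟩⟩
        rw [← hp, SimpleGraph.Walk.length_cons]
        exact Nat.lt_succ_of_le (SimpleGraph.dist_le q)
  choose g hg using hex
  have hr : g r = r := (hg r).1 rfl
  have ha : Attracts g {r} := by
    intro S h0 hS x
    induction hd : T.dist x r using Nat.strong_induction_on generalizing x with
    | _ d ih =>
      by_cases hx : x = r
      · exact h0 hx
      · exact hS x (ih _ (hd ▸ ((hg x).2 hx).2) _ rfl)
  refine ⟨g, hr, ha, ?_⟩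
  have hle : mapGraph g ≤ T := by
    intro x y
    have key : ∀ x y, x ≠ y → g x = y → T.Adj x y := by
      rintro x _ hne rfl
      refine ((hg x).2 ?_).1
      rintro rfl
      exact hne hr.symm
    rintro ⟨hne, h1 | h1⟩
    · exact key x y hne h1
    · exact (key y x hne.symm h1).symm
  have h1 := (SimpleGraph.isTree_iff_connected_and_card.1 hT).2
  have h2 := (SimpleGraph.isTree_iff_connected_and_card.1 (mapGraph_isTree hr ha)).2
  rw [← SimpleGraph.edgeSet_inj]
  refine Set.eq_of_subset_of_ncard_le (SimpleGraph.edgeSet_mono hle) ?_ (Set.toFinite _)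
  change Nat.card _ ≤ Nat.card _
  omega

end MapGraph

/-- The doubly rooted tree of a rooted map. -/
noncomputable def RootedMap.toTree {n : ℕ} (t : RootedMap (Fin n)) : DoublyRootedTree n where
  tree := mapGraph t.1.1
  isTree := mapGraph_isTree t.2.choose_spec.1 t.2.choose_spec.2
  r1 := t.1.2
  r2 := t.2.choose

theorem RootedMap.toTree_bijective (n : ℕ) :
    Function.Bijective (RootedMap.toTree : RootedMap (Fin n) → DoublyRootedTree n) := by
  constructor
  · intro t t' h
    have h1 : mapGraph t.1.1 = mapGraph t'.1.1 := congrArg DoublyRootedTree.tree h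
    have h2 : t.1.2 = t'.1.2 := congrArg DoublyRootedTree.r1 h
    have h3 : t.2.choose = t'.2.choose := congrArg DoublyRootedTree.r2 h
    have h4 := t'.2.choose_spec.1
    rw [← h3] at h4
    exact Subtype.ext
      (Prod.ext (mapGraph_injective t.2.choose_spec.1 t.2.choose_spec.2 h4 h1) h2)
  · rintro ⟨T, hT, a, r⟩
    obtain ⟨g, hr, ha, rfl⟩ := exists_mapGraph_eq hT r
    have h : ∃ r, g r = r ∧ Attracts g {r} := ⟨r, hr, ha⟩
    refine ⟨⟨(g, a), h⟩, ?_⟩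
    have : h.choose = r := by
      have := eq_of_periodic hr ha Nat.one_pos (j := 1) h.choose_spec.1
      exact this
    simp only [toTree, this]

theorem ncard_broken_le {V : Type*} [Finite V] {f s : V → V} (h : FewBroken f s)
    (hc : ∀ x, Broken f s x → inCore f x) : {x | Broken f s x}.ncard ≤ cycleCount f := by
  refine Set.ncard_le_ncard_of_injOn (fun x => {y | ∃ j : ℕ, f^[j] x = y}) ?_ ?_ (Set.toFinite _)
  · intro x hx
    exact ⟨x, hc x hx, rfl⟩
  · intro x hx y hy hxy
    refine h x y hx hy (reach_iff.2 ?_)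
    have : y ∈ {z | ∃ j : ℕ, f^[j] y = z} := ⟨0, rfl⟩
    rwa [← show {z | ∃ j : ℕ, f^[j] x = z} = {z | ∃ j : ℕ, f^[j] y = z} from hxy] at this

theorem msdCard_le {α : Type*} {A B C : Multiset α} (hA : C ≤ A) (hB : C ≤ B) :
    msdCard A B ≤ (A.card - C.card) + (B.card - C.card) := by
  rw [msdCard, Multiset.card_add, ← Multiset.card_sub hA, ← Multiset.card_sub hB]
  exact Nat.add_le_add (Multiset.card_le_card (tsub_le_tsub_left hB A))
    (Multiset.card_le_card (tsub_le_tsub_left hA B))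

theorem msdCard_mapGraph_le {n : ℕ} {f g : Fin n → Fin n} {r : Fin n} (hr : g r = r)
    (h : Attracts g {r}) :
    msdCard (funEdges f) (graphEdges (mapGraph g)) ≤ 2 * {x | Broken f g x}.ncard - 1 := by
  set B : Finset (Fin n) := Finset.univ.filter (Broken f g) with hB
  have hBcard : {x | Broken f g x}.ncard = B.card := by
    rw [← Set.ncard_coe_finset, hB, Finset.coe_filter_univ]
  have hBpos : 0 < B.card := Finset.card_pos.2 ⟨r, by simp [hB, Broken, hr]⟩
  have hBn : B.card + Bᶜ.card = n := by simp
  have hmem : ∀ x ∈ Bᶜ, g x ≠ x ∧ f x = g x := by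
    intro x hx
    simpa [hB, Broken] using hx
  have hA : Bᶜ.val.map (fun x => s(x, f x)) ≤ funEdges f :=
    Multiset.map_le_map (Finset.val_le_iff.2 (Finset.subset_univ _))
  have hC : Bᶜ.val.map (fun x => s(x, f x)) ≤ graphEdges (mapGraph g) := by
    rw [Multiset.map_congr rfl (fun x hx => by rw [(hmem x hx).2] :
      ∀ x ∈ Bᶜ.val, s(x, f x) = s(x, g x))]
    rw [Multiset.le_iff_subset]
    · intro z hz
      obtain ⟨x, hx, rfl⟩ := Multiset.mem_map.1 hz
      rw [graphEdges, Finset.mem_val, Set.Finite.mem_toFinset]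
      exact ⟨(hmem x hx).1.symm, .inl rfl⟩
    · refine Multiset.Nodup.map_on (fun x hx y hy hxy => ?_) (Finset.nodup _)
      refine injOn_edge hr h ?_ ?_ hxy
      · rintro rfl
        exact (hmem x hx).1 hr
      · rintro rfl
        exact (hmem y hy).1 hr
  have hcard := msdCard_le hA hC
  have h1 : (funEdges f).card = n := by simp [funEdges]
  have h2 : (graphEdges (mapGraph g)).card + 1 = n := by
    have := (SimpleGraph.isTree_iff_connected_and_card.1 (mapGraph_isTree hr h)).2
    rwa [Nat.card_fin, Nat.card_coe_set_eq, Set.ncard_eq_toFinset_card _ (Set.toFinite _)] at this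
  rw [Multiset.card_map, Finset.card_val] at hcard
  omega

theorem renyi_joyal_bijection (n : ℕ) (hn : 1 ≤ n) :
    ∃ R : (Fin n → Fin n) ≃ DoublyRootedTree n,
      ∀ f : Fin n → Fin n,
        msdCard (funEdges f) (graphEdges (R f).tree) ≤ 2 * cycleCount f - 1 := by
  have : Nonempty (Fin n) := ⟨⟨0, hn⟩⟩
  obtain ⟨R, hR⟩ := exists_equiv_rootedMap (Fin n)
  refine ⟨R.trans (Equiv.ofBijective _ (RootedMap.toTree_bijective n)), fun f => ?_⟩
  obtain ⟨r, hr, h⟩ := (R f).2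
  have h1 := msdCard_mapGraph_le (f := f) hr h
  have h2 := ncard_broken_le (hR f).1 (hR f).2
  change msdCard (funEdges f) (graphEdges (mapGraph (R f).1.1)) ≤ _
  omega
end
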